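/- Let A be an algebra, T a tolerance on A, and B a subset of A such that B × B ⊆ T and B is maximal with this property (there is no set B' properly containing B with B' × B' ⊆ T). Then B is closed under every idempotent term operation of A: for every natural number n, every L-term t in n variables satisfying t^A(a,a,…,a) = a for all a ∈ A, and all b₁,…,bₙ ∈ B, we have t^A(b₁,…,bₙ) ∈ B. -/

import Mathlib

open FirstOrder.Language FirstOrder.Language.Structure

universe u v w

/-- A binary relation on `A` is compatible with all (interpreted) operations of the
`L`-structure `A`. -/
def Compatible (L : FirstOrder.Language.{u, v}) (A : Type w) [L.Structure A]
    (T : A → A → Prop) : Prop :=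
  ∀ (n : ℕ) (f : L.Functions n) (a b : Fin n → A),
    (∀ i, T (a i) (b i)) → T (funMap f a) (funMap f b)

/-- A tolerance on `A`: a reflexive, symmetric, compatible binary relation. -/
def IsTolerance (L : FirstOrder.Language.{u, v}) (A : Type w) [L.Structure A]
    (T : A → A → Prop) : Prop :=
  Reflexive T ∧ Symmetric T ∧ Compatible L A T

/-- A congruence on `A`: a transitive tolerance. -/
def IsCongruence (L : FirstOrder.Language.{u, v}) (A : Type w) [L.Structure A]
    (T : A → A → Prop) : Prop :=
  IsTolerance L A T ∧ Transitive T

/-- The centralizer condition `C(S, T; δ)`: for every term `t(x, y₁, …, yₙ)`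
(variable `0` playing the role of `x`), every `(a, b) ∈ S` and all pairs
`(uᵢ, vᵢ) ∈ T`, if `(t(a, ū), t(a, v̄)) ∈ δ` then `(t(b, ū), t(b, v̄)) ∈ δ`. -/
def Centralizes (L : FirstOrder.Language.{u, v}) (A : Type w) [L.Structure A]
    (S T δ : A → A → Prop) : Prop :=
  ∀ (n : ℕ) (t : L.Term (Fin (n + 1))) (a b : A), S a b →
    ∀ u v : Fin n → A, (∀ i, T (u i) (v i)) →
      (δ (t.realize (Fin.cons a u)) (t.realize (Fin.cons a v)) →
        δ (t.realize (Fin.cons b u)) (t.realize (Fin.cons b v)))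

/-- A compatible relation is preserved by every term operation. -/
theorem Compatible.realize {L : FirstOrder.Language.{u, v}} {A : Type w} [L.Structure A]
    {T : A → A → Prop} (hT : Compatible L A T) {α : Type*} (t : L.Term α) {a b : α → A}
    (hab : ∀ i, T (a i) (b i)) : T (t.realize a) (t.realize b) := by
  induction t with
  | var i => exact hab i
  | func f ts ih => exact hT _ f _ _ ih

/-- A maximal block `B` of a tolerance `T` (a maximal subset with `B × B ⊆ T`) is
closed under every idempotent term operation of `A`. -/
theorem maximal_block_closed_under_idempotent_terms {L : FirstOrder.Language.{u, v}}
    {A : Type w} [L.Structure A] (T : A → A → Prop) (hT : IsTolerance L A T)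
    (B : Set A) (hB : ∀ a ∈ B, ∀ b ∈ B, T a b)
    (hmax : ∀ B' : Set A, B ⊂ B' → ¬ (∀ a ∈ B', ∀ b ∈ B', T a b)) :
    ∀ (n : ℕ) (t : L.Term (Fin n)), (∀ a : A, t.realize (fun _ => a) = a) →
      ∀ b : Fin n → A, (∀ i, b i ∈ B) → t.realize b ∈ B := by
  intro n t ht b hb
  by_contra hc
  obtain ⟨hrefl, hsymm, hcomp⟩ := hT
  have key : ∀ x ∈ B, T x (t.realize b) := fun x hx => by
    simpa only [ht] using hcomp.realize t (a := fun _ => x) fun i => hB x hx (b i) (hb i)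
  refine hmax (insert (t.realize b) B) (Set.ssubset_insert hc) ?_
  rintro x (rfl | hx) y (rfl | hy)
  · exact hrefl _
  · exact hsymm (key y hy)
  · exact key x hx
  · exact hB x hx y hy
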